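/- For every ξ ∈ ℝ^d with ξ ∉ [−π,π]^d and ξ ∉ 2πℤ^d, one has lim_{k→∞} Λ^k_0(ξ) = 0. -/

import Mathlib

open Filter Complex MeasureTheory

noncomputable section

/-- The lattice point `2π j ∈ ℝ^d` associated with `j ∈ ℤ^d`. -/
def latticePt (d : ℕ) (j : Fin d → ℤ) : EuclideanSpace ℝ (Fin d) :=
  (WithLp.equiv 2 (Fin d → ℝ)).symm fun i => 2 * Real.pi * (j i)

/-- The lattice sum `Σ_{j ∈ ℤ^d, j ≠ 0} |ξ − 2πj|^{−2k}`. -/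
def latticeSum (d k : ℕ) (ξ : EuclideanSpace ℝ (Fin d)) : ℝ :=
  ∑' j : {j : Fin d → ℤ // j ≠ 0}, (‖ξ - latticePt d j.1‖ ^ (2 * k))⁻¹

/-- The function `Λ^k_0(ξ) = (2π)^{−d/2} (1 + |ξ|^{2k} Σ_{j ≠ 0} |ξ − 2πj|^{−2k})⁻¹`. -/
def Lam0 (d k : ℕ) (ξ : EuclideanSpace ℝ (Fin d)) : ℝ :=
  (2 * Real.pi) ^ (-(d : ℝ) / 2) * (1 + ‖ξ‖ ^ (2 * k) * latticeSum d k ξ)⁻¹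

end

lemma latticePt_apply (d : ℕ) (j : Fin d → ℤ) (i : Fin d) :
    latticePt d j i = 2 * Real.pi * j i := rfl

lemma latticePt_injective (d : ℕ) : Function.Injective (latticePt d) := by
  intro j j' h
  funext i
  have hi := congrArg (fun x : EuclideanSpace ℝ (Fin d) => x i) h
  simpa [latticePt_apply, Real.pi_ne_zero] using hi

/-- The basis `2π e_i` of `ℝ^d`, which generates the lattice `2πℤ^d`. -/
noncomputable def twoPiBasis (d : ℕ) : Module.Basis (Fin d) ℝ (EuclideanSpace ℝ (Fin d)) :=
  (EuclideanSpace.basisFun (Fin d) ℝ).toBasis.isUnitSMul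
    (w := fun _ => 2 * Real.pi) fun _ => (by positivity : (2 * Real.pi) ≠ 0).isUnit

lemma latticePt_mem_span (d : ℕ) (j : Fin d → ℤ) :
    latticePt d j ∈ Submodule.span ℤ (Set.range (twoPiBasis d)) := by
  have h : latticePt d j = ∑ i, j i • twoPiBasis d i := by
    ext i
    simp [latticePt_apply, twoPiBasis, Module.Basis.isUnitSMul_apply, Pi.single_apply, mul_comm]
  rw [h]
  exact Submodule.sum_mem _ fun i _ =>
    Submodule.smul_mem _ _ (Submodule.subset_span (Set.mem_range_self i))

lemma summable_norm_sub_latticePt {d n : ℕ} (hn : d < n) (ξ : EuclideanSpace ℝ (Fin d)) :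
    Summable fun j : Fin d → ℤ => (‖ξ - latticePt d j‖ ^ n)⁻¹ := by
  have hrank : Module.finrank ℤ (Submodule.span ℤ (Set.range (twoPiBasis d))) < n := by
    rwa [ZLattice.rank ℝ, finrank_euclideanSpace_fin]
  have h := ZLattice.summable_norm_sub_inv_pow
    (Submodule.span ℤ (Set.range (twoPiBasis d))) n hrank ξ
  have hinj : Function.Injective fun j : Fin d → ℤ =>
      (⟨latticePt d j, latticePt_mem_span d j⟩ :
        Submodule.span ℤ (Set.range (twoPiBasis d))) :=
    fun _ _ hj => latticePt_injective d (congrArg Subtype.val hj)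
  refine (h.comp_injective hinj).congr fun j => ?_
  simp [norm_sub_rev ξ]

/-- A point outside the cube `[-π, π]^d` is closer to some nonzero lattice point than to `0`. -/
lemma exists_norm_sub_latticePt_lt {d : ℕ} {ξ : EuclideanSpace ℝ (Fin d)}
    (hξ : ¬ ∀ i, |ξ i| ≤ Real.pi) :
    ∃ j : Fin d → ℤ, j ≠ 0 ∧ ‖ξ - latticePt d j‖ < ‖ξ‖ := by
  push Not at hξ
  obtain ⟨i, hi⟩ := hξ
  obtain ⟨s, hs, hlt⟩ : ∃ s : ℤ, s ≠ 0 ∧ (ξ i - 2 * Real.pi * s) ^ 2 < ξ i ^ 2 := by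
    have hpi := Real.pi_pos
    rcases lt_abs.mp hi with h | h
    · exact ⟨1, one_ne_zero, by push_cast; nlinarith⟩
    · exact ⟨-1, by decide, by push_cast; nlinarith⟩
  refine ⟨Pi.single i s, by simpa using hs, ?_⟩
  rw [EuclideanSpace.norm_eq, EuclideanSpace.norm_eq]
  refine Real.sqrt_lt_sqrt (by positivity) (Finset.sum_lt_sum (fun l _ => ?_)
    ⟨i, Finset.mem_univ i, ?_⟩)
  · rcases eq_or_ne l i with rfl | hl
    · simpa [latticePt_apply] using hlt.le
    · simp [latticePt_apply, hl]
  · simpa [latticePt_apply] using hlt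

lemma pow_div_le_mul_latticeSum {d k : ℕ} (hk : d < 2 * k) (ξ : EuclideanSpace ℝ (Fin d))
    {j : Fin d → ℤ} (hj : j ≠ 0) :
    (‖ξ‖ / ‖ξ - latticePt d j‖) ^ (2 * k) ≤ ‖ξ‖ ^ (2 * k) * latticeSum d k ξ := by
  rw [div_pow, div_eq_mul_inv]
  have h := ((summable_norm_sub_latticePt hk ξ).subtype {j | j ≠ 0}).le_tsum ⟨j, hj⟩
    fun _ _ => by simp only [Function.comp_apply]; positivity
  exact mul_le_mul_of_nonneg_left h (by positivity)

/-- For `ξ ∉ [−π,π]^d` with `ξ ∉ 2πℤ^d`, one has `Λ^k_0(ξ) → 0` as `k → ∞`. -/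
theorem tendsto_Lam0_zero_of_not_mem_closedCube (d : ℕ) (hd : 0 < d)
    (ξ : EuclideanSpace ℝ (Fin d))
    (hξ : ¬ ∀ i, |ξ i| ≤ Real.pi)
    (hξ' : ∀ j : Fin d → ℤ, ξ ≠ latticePt d j) :
    Tendsto (fun k : ℕ => Lam0 d k ξ) atTop (nhds 0) := by
  obtain ⟨j, hj, hlt⟩ := exists_norm_sub_latticePt_lt hξ
  have hpos : 0 < ‖ξ - latticePt d j‖ := norm_pos_iff.mpr (sub_ne_zero.mpr (hξ' j))
  have hpow : Tendsto (fun k : ℕ => (‖ξ‖ / ‖ξ - latticePt d j‖) ^ (2 * k)) atTop atTop :=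
    (tendsto_pow_atTop_atTop_of_one_lt ((one_lt_div hpos).mpr hlt)).comp
      (tendsto_id.const_mul_atTop' two_pos)
  have hsum : Tendsto (fun k : ℕ => ‖ξ‖ ^ (2 * k) * latticeSum d k ξ) atTop atTop := by
    refine tendsto_atTop_mono' _ ?_ hpow
    filter_upwards [eventually_gt_atTop d] with k hk
    exact pow_div_le_mul_latticeSum (by omega) ξ hj
  simpa [Lam0] using
    (tendsto_inv_atTop_zero.comp (tendsto_atTop_add_const_left atTop 1 hsum)).const_mul
      ((2 * Real.pi) ^ (-(d : ℝ) / 2))
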